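/- arXiv:2106.15892 — 2 statements merged into one kernel-verified Lean document; each statement's English description precedes it below -/
import Mathlib

section
/- Let A = (Q, Σ, δ, I, α) be a TELA in DNF. Then L(A) = L(removeFin_GBA(A)); in particular L(removeFin(A)) = L(removeFin_GBA(A)). -/
namespace TELAFormal

variable {Q A : Type}

/-- Symbolic acceptance conditions of transition-based Emerson-Lei automata:
`tt | ff | Inf(T) | Fin(T) | α ∨ α | α ∧ α` with `T` a set of transitions. -/
inductive AccCond (Q A : Type) : Type where
  | tt : AccCond Q A
  | ff : AccCond Q A
  | inf (T : Set (Q × A × Q)) : AccCond Q A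
  | fin (T : Set (Q × A × Q)) : AccCond Q A
  | disj (a b : AccCond Q A) : AccCond Q A
  | conj (a b : AccCond Q A) : AccCond Q A

/-- Satisfaction of an acceptance condition by a set of transitions. -/
def AccCond.sat (T : Set (Q × A × Q)) : AccCond Q A → Prop
  | .tt => True
  | .ff => False
  | .inf S => (T ∩ S).Nonempty
  | .fin S => T ∩ S = ∅
  | .disj a b => a.sat T ∨ b.sat T
  | .conj a b => a.sat T ∧ b.sat T

/-- All transition sets occurring in the condition are subsets of `δ`. -/
def AccCond.wf (δ : Set (Q × A × Q)) : AccCond Q A → Prop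
  | .tt => True
  | .ff => True
  | .inf S => S ⊆ δ
  | .fin S => S ⊆ δ
  | .disj a b => a.wf δ ∧ b.wf δ
  | .conj a b => a.wf δ ∧ b.wf δ

/-- A transition-based Emerson-Lei automaton (TELA) over state type `Q` and
alphabet `A`: a transition relation, a set of initial states and an
acceptance condition. -/
structure TELA (Q A : Type) where
  delta : Set (Q × A × Q)
  init : Set Q
  acc : AccCond Q A

/-- `ρ` is a run of `M` on the infinite word `u`. -/
def TELA.IsRun (M : TELA Q A) (u : ℕ → A) (ρ : ℕ → Q × A × Q) : Prop :=
  (ρ 0).1 ∈ M.init ∧ ∀ n, ρ n ∈ M.delta ∧ (ρ n).2.1 = u n ∧ (ρ n).2.2 = (ρ (n+1)).1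

/-- The set of transitions occurring infinitely often in `ρ`. -/
def infOcc (ρ : ℕ → Q × A × Q) : Set (Q × A × Q) :=
  {t | ∀ N, ∃ n, N ≤ n ∧ ρ n = t}

/-- The language of a TELA: all infinite words admitting an accepting run. -/
def TELA.Lang (M : TELA Q A) : Set (ℕ → A) :=
  {u | ∃ ρ, M.IsRun u ρ ∧ AccCond.sat (infOcc ρ) M.acc}

/-- `bigOrN f m = f 1 ∨ f 2 ∨ … ∨ f m` (left-associated, `ff` for `m = 0`). -/
def bigOrN (f : ℕ → AccCond Q A) : ℕ → AccCond Q A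
  | 0 => .ff
  | 1 => f 1
  | n+2 => .disj (bigOrN f (n+1)) (f (n+2))

/-- `infConj T k = Inf(T 1) ∧ … ∧ Inf(T k)` (left-associated, `tt` for `k = 0`):
a generalized Büchi condition with acceptance sets `T 1, …, T k`. -/
def infConj (T : ℕ → Set (Q × A × Q)) : ℕ → AccCond Q A
  | 0 => .tt
  | 1 => .inf (T 1)
  | n+2 => .conj (infConj T (n+1)) (.inf (T (n+2)))

/-- The DNF acceptance condition `⋁_{1 ≤ i ≤ m} (Fin(T i 0) ∧ ⋀_{1 ≤ j ≤ k i} Inf(T i j))`. -/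
def dnfAcc (m : ℕ) (k : ℕ → ℕ) (T : ℕ → ℕ → Set (Q × A × Q)) : AccCond Q A :=
  bigOrN (fun i => .conj (.fin (T i 0)) (infConj (T i) (k i))) m

/-- Lift a state map to a map on transitions. -/
def liftTr {Q Q' A : Type} (f : Q → Q') (t : Q × A × Q) : Q' × A × Q' :=
  (f t.1, t.2.1, f t.2.2)

/-- Apply a transition map to all transition sets occurring in a condition. -/
def AccCond.map {Q Q' A : Type} (f : Q × A × Q → Q' × A × Q') :
    AccCond Q A → AccCond Q' A
  | .tt => .tt
  | .ff => .ff
  | .inf S => .inf (f '' S)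
  | .fin S => .fin (f '' S)
  | .disj a b => .disj (a.map f) (b.map f)
  | .conj a b => .conj (a.map f) (b.map f)

section RemoveFin

/-- States of `removeFin(A)`: the main copy `Q` plus one tagged copy `(i, q)`
of `Q` per disjunct `i`. -/
abbrev RFQ (Q : Type) := Q ⊕ (ℕ × Q)

/-- `δ_i`: the `i`-th copy of `δ` with the transitions of `T i 0` removed. -/
def copyDelta (δ : Set (Q × A × Q)) (T : ℕ → ℕ → Set (Q × A × Q)) (i : ℕ) :
    Set (RFQ Q × A × RFQ Q) :=
  {t | ∃ q a q', (q, a, q') ∈ δ \ T i 0 ∧ t = (Sum.inr (i, q), a, Sum.inr (i, q'))}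

/-- `U i j`: the copy of `T i j ∖ T i 0` inside the `i`-th copy. -/
def copyU (T : ℕ → ℕ → Set (Q × A × Q)) (i j : ℕ) : Set (RFQ Q × A × RFQ Q) :=
  {t | ∃ q a q', (q, a, q') ∈ T i j \ T i 0 ∧ t = (Sum.inr (i, q), a, Sum.inr (i, q'))}

/-- The transitions `{(q, a, q'^(i)) | (q,a,q') ∈ δ}` from the main copy into copy `i`. -/
def copyBridge (δ : Set (Q × A × Q)) (i : ℕ) : Set (RFQ Q × A × RFQ Q) :=
  {t | ∃ q a q', (q, a, q') ∈ δ ∧ t = (Sum.inl q, a, Sum.inr (i, q'))}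

/-- The transition relation `δ'` of `removeFin(A)`. -/
def rfDelta (δ : Set (Q × A × Q)) (T : ℕ → ℕ → Set (Q × A × Q)) (m : ℕ) :
    Set (RFQ Q × A × RFQ Q) :=
  liftTr Sum.inl '' δ ∪
    ⋃ i ∈ Finset.Icc 1 m, (copyDelta δ T i ∪ copyBridge δ i)

/-- `φ_i = ⋀_{1 ≤ j ≤ k i} Inf(U i j)`. -/
def rfPhi (T : ℕ → ℕ → Set (Q × A × Q)) (k : ℕ → ℕ) (i : ℕ) : AccCond (RFQ Q) A :=
  infConj (fun j => copyU T i j) (k i)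

/-- `removeFin(A)` with acceptance `α' = ⋁_{1 ≤ i ≤ m} φ_i`. -/
def removeFin (δ : Set (Q × A × Q)) (T : ℕ → ℕ → Set (Q × A × Q))
    (I : Set Q) (m : ℕ) (k : ℕ → ℕ) : TELA (RFQ Q) A :=
  ⟨rfDelta δ T m, Sum.inl '' I, bigOrN (fun i => rfPhi T k i) m⟩

/-- `removeFin_GBA(A)` with acceptance
`α'' = ⋀_{1 ≤ j ≤ k} Inf(U 1 j ∪ … ∪ U m j)`, where `k = maxᵢ k i` and
`U i j := δ_i` for `k i < j ≤ k`. -/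
def removeFinGBA (δ : Set (Q × A × Q)) (T : ℕ → ℕ → Set (Q × A × Q))
    (I : Set Q) (m : ℕ) (k : ℕ → ℕ) : TELA (RFQ Q) A :=
  ⟨rfDelta δ T m, Sum.inl '' I,
   infConj
     (fun j => ⋃ i ∈ Finset.Icc 1 m,
       (if j ≤ k i then copyU T i j else copyDelta δ T i))
     ((Finset.Icc 1 m).sup k)⟩

end RemoveFin

theorem AccCond.sat_bigOrN (X : Set (Q × A × Q)) (f : ℕ → AccCond Q A) (m : ℕ) :
    (bigOrN f m).sat X ↔ ∃ i, 1 ≤ i ∧ i ≤ m ∧ (f i).sat X := by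
  induction m with
  | zero =>
    simp only [bigOrN, AccCond.sat, false_iff]
    rintro ⟨i, h1, h2, -⟩
    omega
  | succ n ih =>
    cases n with
    | zero =>
      refine ⟨fun h => ⟨1, le_rfl, le_rfl, h⟩, ?_⟩
      rintro ⟨i, h1, h2, h⟩
      obtain rfl : i = 1 := by omega
      exact h
    | succ n =>
      simp only [bigOrN, AccCond.sat, ih]
      constructor
      · rintro (⟨i, h1, h2, h⟩ | h)
        · exact ⟨i, h1, by omega, h⟩
        · exact ⟨n + 2, by omega, le_rfl, h⟩
      · rintro ⟨i, h1, h2, h⟩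
        rcases Nat.lt_or_ge i (n + 2) with hi | hi
        · exact Or.inl ⟨i, h1, by omega, h⟩
        · obtain rfl : i = n + 2 := by omega
          exact Or.inr h

theorem AccCond.sat_infConj (X : Set (Q × A × Q)) (T : ℕ → Set (Q × A × Q)) (k : ℕ) :
    (infConj T k).sat X ↔ ∀ j, 1 ≤ j → j ≤ k → (X ∩ T j).Nonempty := by
  induction k with
  | zero =>
    simp only [infConj, AccCond.sat, true_iff]
    intro j h1 h2
    omega
  | succ n ih =>
    cases n with
    | zero =>
      refine ⟨fun h j h1 h2 => ?_, fun h => h 1 le_rfl le_rfl⟩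
      obtain rfl : j = 1 := by omega
      exact h
    | succ n =>
      simp only [infConj, AccCond.sat, ih]
      constructor
      · rintro ⟨h, h'⟩ j h1 h2
        rcases Nat.lt_or_ge j (n + 2) with hj | hj
        · exact h j h1 (by omega)
        · obtain rfl : j = n + 2 := by omega
          exact h'
      · intro h
        exact ⟨fun j h1 h2 => h j h1 (by omega), h (n + 2) (by omega) le_rfl⟩

/-- On a finite set of transitions, a sequence disjoint from `S` in the limit eventually
avoids `S`. -/
theorem exists_forall_notMem_of_infOcc_inter_eq_empty [Finite Q] [Finite A]
    {ρ : ℕ → Q × A × Q} {S : Set (Q × A × Q)} (h : infOcc ρ ∩ S = ∅) :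
    ∃ N, ∀ n, N ≤ n → ρ n ∉ S := by
  have hev : ∀ t : Q × A × Q, ∀ᶠ n in Filter.atTop, ρ n = t → t ∉ S := by
    intro t
    by_cases ht : t ∈ S
    · have hocc : t ∉ infOcc ρ := fun hr => Set.eq_empty_iff_forall_notMem.1 h t ⟨hr, ht⟩
      simp only [infOcc, Set.mem_ofPred_eq, not_forall, not_exists, not_and] at hocc
      obtain ⟨N, hN⟩ := hocc
      exact Filter.eventually_atTop.2 ⟨N, fun n hn e => absurd e (hN n hn)⟩
    · exact Filter.Eventually.of_forall fun _ _ => ht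
  obtain ⟨N, hN⟩ := Filter.eventually_atTop.1 (Filter.eventually_all.2 hev)
  exact ⟨N, fun n hn => hN n hn _ rfl⟩

section RemoveFinRuns

variable {δ : Set (Q × A × Q)} {T : ℕ → ℕ → Set (Q × A × Q)} {I : Set Q} {m : ℕ}

theorem mem_copyDelta_of_fst_eq_inr {t : RFQ Q × A × RFQ Q} (ht : t ∈ rfDelta δ T m)
    {i : ℕ} {q : Q} (hq : t.1 = Sum.inr (i, q)) : t ∈ copyDelta δ T i := by
  rcases ht with ⟨s, -, rfl⟩ | ht
  · simp [liftTr] at hq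
  · simp only [Set.mem_iUnion] at ht
    obtain ⟨i', -, ⟨p, a, p', h, rfl⟩ | ⟨p, a, p', h, rfl⟩⟩ := ht
    · simp only [Sum.inr.injEq, Prod.mk.injEq] at hq
      obtain ⟨rfl, rfl⟩ := hq
      exact ⟨p, a, p', h, rfl⟩
    · simp at hq

theorem copyU_subset_copyDelta {i j : ℕ} (h : T i j ⊆ δ) :
    copyU T i j ⊆ copyDelta δ T i := by
  rintro _ ⟨q, a, q', ⟨h1, h2⟩, rfl⟩
  exact ⟨q, a, q', ⟨h h1, h2⟩, rfl⟩

theorem eq_of_mem_copyDelta {i i' : ℕ} {t : RFQ Q × A × RFQ Q}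
    (h : t ∈ copyDelta δ T i) (h' : t ∈ copyDelta δ T i') : i = i' := by
  obtain ⟨q, a, q', -, rfl⟩ := h
  obtain ⟨p, b, p', -, h⟩ := h'
  simp only [Prod.mk.injEq, Sum.inr.injEq] at h
  exact h.1.1

/-- The projection from the states of `removeFin(A)` to those of `A`. -/
def rfProj : RFQ Q → Q := Sum.elim id Prod.snd

theorem liftTr_rfProj_mem {t : RFQ Q × A × RFQ Q} (ht : t ∈ rfDelta δ T m) :
    liftTr rfProj t ∈ δ := by
  rcases ht with ⟨s, hs, rfl⟩ | ht
  · exact hs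
  · simp only [Set.mem_iUnion] at ht
    obtain ⟨i', -, ⟨p, a, p', h, rfl⟩ | ⟨p, a, p', h, rfl⟩⟩ := ht
    · exact h.1
    · exact h

theorem TELA.IsRun.rfProj {α : AccCond (RFQ Q) A} (β : AccCond Q A) {u : ℕ → A}
    {ρ : ℕ → RFQ Q × A × RFQ Q}
    (h : TELA.IsRun ⟨rfDelta δ T m, Sum.inl '' I, α⟩ u ρ) :
    TELA.IsRun ⟨δ, I, β⟩ u fun n => liftTr rfProj (ρ n) := by
  obtain ⟨⟨q, hq, hq'⟩, h⟩ := h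
  refine ⟨?_, fun n => ⟨liftTr_rfProj_mem (h n).1, (h n).2.1,
    congrArg TELAFormal.rfProj (h n).2.2⟩⟩
  change TELAFormal.rfProj (ρ 0).1 ∈ I
  rw [← hq']
  exact hq

/-- A run of `removeFin(A)` that enters the `i`-th copy never leaves it. -/
theorem TELA.IsRun.exists_forall_mem_copyDelta {α : AccCond (RFQ Q) A} {u : ℕ → A}
    {ρ : ℕ → RFQ Q × A × RFQ Q}
    (h : TELA.IsRun ⟨rfDelta δ T m, Sum.inl '' I, α⟩ u ρ) {i : ℕ}
    (hi : (infOcc ρ ∩ copyDelta δ T i).Nonempty) :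
    ∃ N, ∀ n, N ≤ n → ρ n ∈ copyDelta δ T i := by
  obtain ⟨t, ht, hti⟩ := hi
  obtain ⟨N, -, rfl⟩ := ht 0
  refine ⟨N, fun n hn => ?_⟩
  induction n, hn using Nat.le_induction with
  | base => exact hti
  | succ n _ ih =>
    obtain ⟨q, a, q', -, e⟩ := ih
    refine mem_copyDelta_of_fst_eq_inr (h.2 (n + 1)).1 (q := q') ?_
    rw [← (h.2 n).2.2, e]

theorem TELA.mem_Lang_of_isRun_rfDelta {k : ℕ → ℕ} {α : AccCond (RFQ Q) A} {u : ℕ → A}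
    {ρ : ℕ → RFQ Q × A × RFQ Q}
    (h : TELA.IsRun ⟨rfDelta δ T m, Sum.inl '' I, α⟩ u ρ) {i : ℕ} (h1 : 1 ≤ i) (hm : i ≤ m)
    (hi : (infOcc ρ ∩ copyDelta δ T i).Nonempty)
    (hU : ∀ j, 1 ≤ j → j ≤ k i → (infOcc ρ ∩ copyU T i j).Nonempty) :
    u ∈ TELA.Lang ⟨δ, I, dnfAcc m k T⟩ := by
  refine ⟨_, h.rfProj _, (AccCond.sat_bigOrN _ _ _).2 ⟨i, h1, hm, ?_,
    (AccCond.sat_infConj _ _ _).2 fun j hj hjk => ?_⟩⟩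
  · obtain ⟨N, hN⟩ := h.exists_forall_mem_copyDelta hi
    refine Set.eq_empty_iff_forall_notMem.2 ?_
    rintro t ⟨ht, htT⟩
    obtain ⟨n, hn, rfl⟩ := ht N
    obtain ⟨q, a, q', hq, e⟩ := hN n hn
    simp only [e] at htT
    exact hq.2 htT
  · obtain ⟨t, ht, q, a, q', hq, rfl⟩ := hU j hj hjk
    refine ⟨(q, a, q'), fun N => ?_, hq.1⟩
    obtain ⟨n, hn, e⟩ := ht N
    exact ⟨n, hn, by simp only [e]; rfl⟩

/-- A run of `A` that eventually avoids `T i 0` can be moved to the `i`-th copy. -/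
theorem TELA.IsRun.exists_isRun_rfDelta {β : AccCond Q A} (α : AccCond (RFQ Q) A)
    {u : ℕ → A} {ρ : ℕ → Q × A × Q} (h : TELA.IsRun ⟨δ, I, β⟩ u ρ) {i : ℕ}
    (h1 : 1 ≤ i) (hm : i ≤ m) {N : ℕ} (hN : ∀ n, N ≤ n → ρ n ∉ T i 0) :
    ∃ ρ' : ℕ → RFQ Q × A × RFQ Q, TELA.IsRun ⟨rfDelta δ T m, Sum.inl '' I, α⟩ u ρ' ∧
      ∀ n, N < n → ρ' n = liftTr (fun q => Sum.inr (i, q)) (ρ n) := by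
  let s : ℕ → Q → RFQ Q := fun n q => if n ≤ N then Sum.inl q else Sum.inr (i, q)
  refine ⟨fun n => (s n (ρ n).1, (ρ n).2.1, s (n + 1) (ρ n).2.2), ⟨?_, fun n => ⟨?_, ?_, ?_⟩⟩,
    fun n hn => ?_⟩
  · exact ⟨_, h.1, by simp [s]⟩
  · have hmem := (h.2 n).1
    have hcopy : ∀ x, x ∈ copyDelta δ T i ∪ copyBridge δ i → x ∈ rfDelta δ T m := fun x hx =>
      Or.inr (Set.mem_biUnion (Finset.mem_coe.2 (Finset.mem_Icc.2 ⟨h1, hm⟩)) hx)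
    rcases lt_trichotomy n N with hn | rfl | hn
    · refine Or.inl ⟨ρ n, hmem, ?_⟩
      simp [s, liftTr, hn.le, Nat.succ_le_of_lt hn]
    · refine hcopy _ (Or.inr ⟨_, _, _, hmem, ?_⟩)
      simp [s]
    · refine hcopy _ (Or.inl ⟨_, _, _, ⟨hmem, hN n hn.le⟩, ?_⟩)
      simp [s, hn.not_ge, (Nat.lt_succ_of_lt hn).not_ge]
  · exact (h.2 n).2.1
  · exact congrArg (s (n + 1)) (h.2 n).2.2
  · simp [s, liftTr, hn.not_ge, (Nat.lt_succ_of_lt hn).not_ge]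

theorem TELA.exists_isRun_rfDelta_of_mem_Lang [Finite Q] [Finite A] {k : ℕ → ℕ}
    (α : AccCond (RFQ Q) A) {u : ℕ → A} (hu : u ∈ TELA.Lang ⟨δ, I, dnfAcc m k T⟩) :
    ∃ ρ, TELA.IsRun ⟨rfDelta δ T m, Sum.inl '' I, α⟩ u ρ ∧ ∃ i, 1 ≤ i ∧ i ≤ m ∧
      ∀ j, 1 ≤ j → j ≤ k i → (infOcc ρ ∩ copyU T i j).Nonempty := by
  obtain ⟨ρ, hρ, hacc⟩ := hu
  obtain ⟨i, h1, hm, hfin, hinf⟩ := (AccCond.sat_bigOrN _ _ _).1 hacc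
  rw [AccCond.sat_infConj] at hinf
  obtain ⟨N, hN⟩ := exists_forall_notMem_of_infOcc_inter_eq_empty hfin
  obtain ⟨ρ', hρ', hlift⟩ := hρ.exists_isRun_rfDelta α h1 hm hN
  refine ⟨ρ', hρ', i, h1, hm, fun j hj hjk => ?_⟩
  obtain ⟨t, ht, htj⟩ := hinf j hj hjk
  refine ⟨liftTr (fun q => Sum.inr (i, q)) t, fun M => ?_, t.1, t.2.1, t.2.2, ⟨htj, ?_⟩, rfl⟩
  · obtain ⟨n, hn, rfl⟩ := ht (max M (N + 1))
    exact ⟨n, (le_max_left _ _).trans hn, hlift n ((le_max_right _ _).trans hn)⟩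
  · obtain ⟨n, hn, rfl⟩ := ht N
    exact hN n hn

end RemoveFinRuns

theorem lang_removeFin [Finite Q] [Finite A]
    (δ : Set (Q × A × Q)) (I : Set Q)
    (m : ℕ) (k : ℕ → ℕ) (T : ℕ → ℕ → Set (Q × A × Q))
    (hk : ∀ i, 1 ≤ i → i ≤ m → 1 ≤ k i)
    (hT : ∀ i j, 1 ≤ i → i ≤ m → j ≤ k i → T i j ⊆ δ) :
    TELA.Lang ⟨δ, I, dnfAcc m k T⟩ = (removeFin δ T I m k).Lang := by
  ext u
  constructor
  · intro hu
    obtain ⟨ρ, hρ, i, h1, hm, hU⟩ := TELA.exists_isRun_rfDelta_of_mem_Lang _ hu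
    exact ⟨ρ, hρ, (AccCond.sat_bigOrN _ _ _).2
      ⟨i, h1, hm, (AccCond.sat_infConj _ _ _).2 hU⟩⟩
  · rintro ⟨ρ, hρ, hacc⟩
    obtain ⟨i, h1, hm, hi⟩ := (AccCond.sat_bigOrN _ _ _).1 hacc
    have hU := (AccCond.sat_infConj _ _ _).1 hi
    have hki := hk i h1 hm
    exact TELA.mem_Lang_of_isRun_rfDelta hρ h1 hm
      ((hU 1 le_rfl hki).mono
        (Set.inter_subset_inter_right _ (copyU_subset_copyDelta (hT i 1 h1 hm hki)))) hU

/-- For a TELA `A` in DNF, `L(A) = L(removeFin_GBA(A))`; in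
particular `L(removeFin(A)) = L(removeFin_GBA(A))`. -/
theorem lang_removeFinGBA {Q A : Type} [Finite Q] [Finite A]
    (δ : Set (Q × A × Q)) (I : Set Q)
    (m : ℕ) (k : ℕ → ℕ) (T : ℕ → ℕ → Set (Q × A × Q))
    (hm : 1 ≤ m) (hk : ∀ i, 1 ≤ i → i ≤ m → 1 ≤ k i)
    (hT : ∀ i j, 1 ≤ i → i ≤ m → j ≤ k i → T i j ⊆ δ) :
    TELA.Lang ⟨δ, I, dnfAcc m k T⟩ = (removeFinGBA δ T I m k).Lang ∧
    (removeFin δ T I m k).Lang = (removeFinGBA δ T I m k).Lang := by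
  have hGBA : TELA.Lang ⟨δ, I, dnfAcc m k T⟩ = (removeFinGBA δ T I m k).Lang := by
    have hsub : ∀ i j, 1 ≤ i → i ≤ m →
        (if j ≤ k i then copyU T i j else copyDelta δ T i) ⊆ copyDelta δ T i := by
      intro i j h1 hi
      split_ifs with hj
      · exact copyU_subset_copyDelta (hT i j h1 hi hj)
      · exact subset_rfl
    ext u
    constructor
    · intro hu
      obtain ⟨ρ, hρ, i, h1, hi, hU⟩ := TELA.exists_isRun_rfDelta_of_mem_Lang _ hu
      refine ⟨ρ, hρ, (AccCond.sat_infConj _ _ _).2 fun j hj _ => ?_⟩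
      obtain ⟨t, ht, htU⟩ : (infOcc ρ ∩
          (if j ≤ k i then copyU T i j else copyDelta δ T i)).Nonempty := by
        split_ifs with hjk
        · exact hU j hj hjk
        · have hki := hk i h1 hi
          exact (hU 1 le_rfl hki).mono
            (Set.inter_subset_inter_right _ (copyU_subset_copyDelta (hT i 1 h1 hi hki)))
      exact ⟨t, ht, Set.mem_biUnion (Finset.mem_coe.2 (Finset.mem_Icc.2 ⟨h1, hi⟩)) htU⟩
    · rintro ⟨ρ, hρ, hacc⟩
      have hU := (AccCond.sat_infConj _ _ _).1 hacc
      have hle : ∀ i, 1 ≤ i → i ≤ m → k i ≤ (Finset.Icc 1 m).sup k := fun i h1 hi =>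
        Finset.le_sup (f := k) (Finset.mem_Icc.2 ⟨h1, hi⟩)
      obtain ⟨t, ht, htU⟩ := hU 1 le_rfl ((hk 1 le_rfl hm).trans (hle 1 le_rfl hm))
      simp only [Set.mem_iUnion, Finset.mem_Icc] at htU
      obtain ⟨i, ⟨h1, hi⟩, hti⟩ := htU
      have hcopy : (infOcc ρ ∩ copyDelta δ T i).Nonempty := ⟨t, ht, hsub i 1 h1 hi hti⟩
      refine TELA.mem_Lang_of_isRun_rfDelta hρ h1 hi hcopy fun j hj hjk => ?_
      obtain ⟨s, hs, hsU⟩ := hU j hj (hjk.trans (hle i h1 hi))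
      simp only [Set.mem_iUnion, Finset.mem_Icc] at hsU
      obtain ⟨i', ⟨h1', hi'⟩, hsi⟩ := hsU
      obtain ⟨N, hN⟩ := TELA.IsRun.exists_forall_mem_copyDelta hρ hcopy
      obtain ⟨n, hn, rfl⟩ := hs N
      obtain rfl := eq_of_mem_copyDelta (hN n hn) (hsub i' j h1' hi' hsi)
      rw [if_pos hjk] at hsi
      exact ⟨_, hs, hsi⟩
  exact ⟨hGBA, (lang_removeFin δ I m k T hk hT).symm.trans hGBA⟩

end TELAFormal
end

section
/- For every TELA B = (Q, Σ, δ, I, β) with N = |Q| ≥ 1 states (β not necessarily in DNF) there exists a limit-deterministic TELA G over Σ whose acceptance condition is a Büchi condition Inf(T) for some set T of transitions of G, such that L(G) = L(B) and the number of states of G is at most 2^{2(|β|+N)+2}. -/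
namespace TELAFormal

variable {Q A : Type}

/-- `|α|`: the number of atomic conditions in `α`, counted with multiplicity. -/
def AccCond.size : AccCond Q A → ℕ
  | .tt => 1
  | .ff => 1
  | .inf _ => 1
  | .fin _ => 1
  | .disj a b => a.size + b.size
  | .conj a b => a.size + b.size

/-- A TELA is complete if every state has an `a`-successor for every letter `a`. -/
def TELA.Complete (M : TELA Q A) : Prop :=
  ∀ q a, ∃ q', (q, a, q') ∈ M.delta

/-- A TELA is deterministic if it has exactly one initial state and the
transition relation is a function `Q × A → Q`. -/
def TELA.Deterministic (M : TELA Q A) : Prop :=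
  (∃ q₀, M.init = {q₀}) ∧ ∀ q a, ∃! q', (q, a, q') ∈ M.delta

/-- A TELA is limit-deterministic: there is a partition of the states into
`QD` and its complement `Q_N` such that (1) no transition leaves `QD`,
(2) states in `QD` have at most one `a`-successor for every `a`, and
(3) every accepting run eventually stops using transitions inside `Q_N`. -/
def TELA.LimitDet (M : TELA Q A) : Prop :=
  ∃ QD : Set Q,
    (∀ t ∈ M.delta, t.1 ∈ QD → t.2.2 ∈ QD) ∧
    (∀ q ∈ QD, ∀ a q₁ q₂, (q, a, q₁) ∈ M.delta → (q, a, q₂) ∈ M.delta → q₁ = q₂) ∧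
    (∀ u ρ, M.IsRun u ρ → AccCond.sat (infOcc ρ) M.acc →
      infOcc ρ ∩ {t | t.1 ∉ QD ∧ t.2.2 ∉ QD} = ∅)

section Auxiliary

open Filter

lemma infOcc_inter_nonempty [Finite Q] [Finite A] (ρ : ℕ → Q × A × Q) (X : Set (Q × A × Q)) :
    (infOcc ρ ∩ X).Nonempty ↔ ∀ N, ∃ n, N ≤ n ∧ ρ n ∈ X := by
  constructor
  · rintro ⟨t, ht, htX⟩ N
    obtain ⟨n, hn, rfl⟩ := ht N
    exact ⟨n, hn, htX⟩
  · intro h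
    by_contra hcon
    have h1 : ∀ t : Q × A × Q, ∀ᶠ n in atTop, ρ n = t → t ∉ X := by
      intro t
      by_cases htX : t ∈ X
      · have : t ∉ infOcc ρ := fun ht => hcon ⟨t, ht, htX⟩
        simp only [infOcc, Set.mem_ofPred_eq, not_forall, not_exists, not_and] at this
        obtain ⟨N, hN⟩ := this
        filter_upwards [eventually_ge_atTop N] with n hn h
        exact absurd h (hN n hn)
      · exact Eventually.of_forall fun _ _ => htX
    obtain ⟨N, hN⟩ := eventually_atTop.1 (eventually_all.2 h1)
    obtain ⟨n, hn, hX⟩ := h N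
    exact hN n hn _ rfl hX

lemma infOcc_inter_eq_empty [Finite Q] [Finite A] (ρ : ℕ → Q × A × Q) (X : Set (Q × A × Q)) :
    infOcc ρ ∩ X = ∅ ↔ ∃ N, ∀ n, N ≤ n → ρ n ∉ X := by
  rw [← Set.not_nonempty_iff_eq_empty, infOcc_inter_nonempty]
  push Not
  rfl

lemma AccCond.one_le_size (α : AccCond Q A) : 1 ≤ α.size := by
  induction α <;> simp only [AccCond.size] <;> omega

/-- Disjunctive normal form: a condition of size `k` is equivalent, on nonempty sets, to a
disjunction of at most `2 ^ k` conditions `Fin (F d) ∧ ⋀ i, Inf (T d i)` where only the first `k`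
sets `T d i` are nontrivial. -/
lemma AccCond.exists_dnf (α : AccCond Q A) :
    ∃ (D : Type) (_ : Finite D) (F : D → Set (Q × A × Q)) (T : D → ℕ → Set (Q × A × Q)),
      Nat.card D ≤ 2 ^ α.size ∧ (∀ d i, α.size ≤ i → T d i = Set.univ) ∧
      ∀ X : Set (Q × A × Q), X.Nonempty →
        (α.sat X ↔ ∃ d, X ∩ F d = ∅ ∧ ∀ i, (X ∩ T d i).Nonempty) := by
  induction α with
  | tt => exact ⟨Unit, inferInstance, fun _ => ∅, fun _ _ => Set.univ, by simp [AccCond.size],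
      by simp, fun X hX => by simp [AccCond.sat, hX]⟩
  | ff => exact ⟨Empty, inferInstance, fun _ => ∅, fun _ _ => Set.univ, by simp,
      by simp, fun X hX => by simp [AccCond.sat]⟩
  | inf S =>
    refine ⟨Unit, inferInstance, fun _ => ∅, fun _ i => if i = 0 then S else Set.univ,
      by simp [AccCond.size], ?_, fun X hX => ?_⟩
    · intro _ i hi
      simp only [AccCond.size] at hi
      simp [show i ≠ 0 by omega]
    · simp only [AccCond.sat, Set.inter_empty, true_and, exists_const]
      constructor
      · intro h i
        split_ifs
        · exact h
        · simpa using hX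
      · intro h
        simpa using h 0
  | fin S => exact ⟨Unit, inferInstance, fun _ => S, fun _ _ => Set.univ, by simp [AccCond.size],
      by simp, fun X hX => by simp [AccCond.sat, hX]⟩
  | disj a b iha ihb =>
    obtain ⟨D₁, _, F₁, T₁, hc₁, hT₁, h₁⟩ := iha
    obtain ⟨D₂, _, F₂, T₂, hc₂, hT₂, h₂⟩ := ihb
    refine ⟨D₁ ⊕ D₂, inferInstance, Sum.elim F₁ F₂, Sum.elim T₁ T₂, ?_, ?_, fun X hX => ?_⟩
    · rw [Nat.card_sum, AccCond.size]
      have ha := Nat.pow_le_pow_right (show 0 < 2 by norm_num) a.one_le_size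
      have hb := Nat.pow_le_pow_right (show 0 < 2 by norm_num) b.one_le_size
      rw [pow_add]
      nlinarith
    · rintro (d | d) i hi <;> simp only [AccCond.size] at hi
      · exact hT₁ d i (by omega)
      · exact hT₂ d i (by omega)
    · simp [AccCond.sat, h₁ X hX, h₂ X hX]
  | conj a b iha ihb =>
    obtain ⟨D₁, _, F₁, T₁, hc₁, hT₁, h₁⟩ := iha
    obtain ⟨D₂, _, F₂, T₂, hc₂, hT₂, h₂⟩ := ihb
    refine ⟨D₁ × D₂, inferInstance, fun d => F₁ d.1 ∪ F₂ d.2,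
      fun d i => if i < a.size then T₁ d.1 i else T₂ d.2 (i - a.size), ?_, ?_, fun X hX => ?_⟩
    · rw [Nat.card_prod, AccCond.size, pow_add]
      exact Nat.mul_le_mul hc₁ hc₂
    · intro d i hi
      simp only [AccCond.size] at hi
      refine (if_neg (by omega)).trans ?_
      exact hT₂ _ _ (by omega)
    · simp only [AccCond.sat, h₁ X hX, h₂ X hX, Prod.exists, Set.inter_union_distrib_left,
        Set.union_empty_iff]
      constructor
      · rintro ⟨⟨d, hd, hd'⟩, e, he, he'⟩
        refine ⟨d, e, ⟨hd, he⟩, fun i => ?_⟩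
        split_ifs
        · exact hd' i
        · exact he' _
      · rintro ⟨d, e, ⟨hd, he⟩, h⟩
        refine ⟨⟨d, hd, fun i => ?_⟩, e, he, fun i => ?_⟩
        · by_cases hi : i < a.size
          · simpa [hi] using h i
          · rw [hT₁ d i (by omega)]
            simpa using hX
        · simpa using h (i + a.size)

/-- Reachability from `q₀` at time `m` along time-dependent edges. -/
inductive Reach (E : ℕ → Q → Q → Prop) (m : ℕ) (q₀ : Q) : ℕ → Q → Prop
  | base : Reach E m q₀ m q₀
  | step {n : ℕ} {p q : Q} : Reach E m q₀ n p → E n p q → Reach E m q₀ (n + 1) q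

lemma Reach.le {E : ℕ → Q → Q → Prop} {m n : ℕ} {p q : Q} (h : Reach E m p n q) : m ≤ n := by
  induction h with
  | base => exact le_rfl
  | step _ _ ih => omega

lemma Reach.trans {E : ℕ → Q → Q → Prop} {l m n : ℕ} {o p q : Q} (h₁ : Reach E l o m p)
    (h₂ : Reach E m p n q) : Reach E l o n q := by
  induction h₂ with
  | base => exact h₁
  | step _ he ih => exact ih.step he

lemma Reach.head {E : ℕ → Q → Q → Prop} {m n : ℕ} {p q : Q} (h : Reach E m p n q) (hmn : m < n) :
    ∃ p', E m p p' ∧ Reach E (m + 1) p' n q := by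
  induction h with
  | base => omega
  | @step n r q hr he ih =>
    rcases hr.le.eq_or_lt with rfl | hlt
    · cases hr with
      | base => exact ⟨q, he, .base⟩
      | step hr' _ => have := hr'.le; omega
    · obtain ⟨p', h1, h2⟩ := ih hlt
      exact ⟨p', h1, h2.step he⟩

lemma Reach.eq_of_self {E : ℕ → Q → Q → Prop} {m : ℕ} {p q : Q} (h : Reach E m p m q) : q = p := by
  generalize hn : m = n at h
  cases h with
  | base => rfl
  | step h' _ => have := h'.le; omega

lemma Reach.last {E : ℕ → Q → Q → Prop} {m n : ℕ} {p q : Q} (h : Reach E m p (n + 1) q)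
    (hmn : m ≤ n) : ∃ r, Reach E m p n r ∧ E n r q := by
  generalize hk : n + 1 = k at h
  cases h with
  | base => omega
  | step h' he =>
    obtain rfl : n = _ := Nat.succ.inj hk
    exact ⟨_, h', he⟩

lemma Reach.of_seq {E : ℕ → Q → Q → Prop} {r : ℕ → Q} {m : ℕ}
    (hr : ∀ n, m ≤ n → E n (r n) (r (n + 1))) {n : ℕ} (hmn : m ≤ n) :
    Reach E m (r m) n (r n) := by
  induction n, hmn using Nat.le_induction with
  | base => exact .base
  | succ n hn ih => exact ih.step (hr n hn)

/-- König's lemma for layered graphs with finite layers. -/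
lemma exists_seq_of_layers [Finite Q] (V : ℕ → Set Q) (E : ℕ → Q → Q → Prop)
    (hV : ∀ n, (V n).Nonempty) (hE : ∀ n, ∀ q ∈ V (n + 1), ∃ p ∈ V n, E n p q) :
    ∃ f : ℕ → Q, ∀ n, f n ∈ V n ∧ E n (f n) (f (n + 1)) := by
  let E' : ℕ → Q → Q → Prop := fun n p q => p ∈ V n ∧ E n p q
  have back : ∀ n, ∀ q ∈ V n, ∃ p, Reach E' 0 p n q := by
    intro n
    induction n with
    | zero => exact fun q _ => ⟨q, .base⟩
    | succ n ih =>
      intro q hq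
      obtain ⟨p, hp, he⟩ := hE n q hq
      obtain ⟨o, ho⟩ := ih p hp
      exact ⟨o, ho.step ⟨hp, he⟩⟩
  have start : ∃ q, ∃ᶠ m in atTop, ∃ z, Reach E' 0 q m z := by
    by_contra! h
    obtain ⟨N, hN⟩ := eventually_atTop.1 (eventually_all.2 h)
    obtain ⟨z, hz⟩ := hV N
    obtain ⟨p, hp⟩ := back N z hz
    exact hN N le_rfl p z hp
  have next : ∀ n q, (∃ᶠ m in atTop, ∃ z, Reach E' n q m z) →
      ∃ q', E' n q q' ∧ ∃ᶠ m in atTop, ∃ z, Reach E' (n + 1) q' m z := by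
    intro n q hq
    by_contra! h
    have h' : ∀ q', ∀ᶠ m in atTop, E' n q q' → ∀ z, ¬ Reach E' (n + 1) q' m z := by
      intro q'
      by_cases he : E' n q q'
      · filter_upwards [h q' he] with m hm _ using hm
      · exact Eventually.of_forall fun _ h => absurd h he
    obtain ⟨m, ⟨z, hz⟩, hm, hmn⟩ :=
      (hq.and_eventually ((eventually_all.2 h').and (eventually_gt_atTop n))).exists
    obtain ⟨q', he, hr⟩ := hz.head hmn
    exact hm q' he z hr
  choose! g hg using next
  obtain ⟨q₀, hq₀⟩ := start
  let f : ℕ → Q := fun n => Nat.rec q₀ g n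
  have hf : ∀ n, ∃ᶠ m in atTop, ∃ z, Reach E' n (f n) m z := by
    intro n
    induction n with
    | zero => exact hq₀
    | succ n ih => exact (hg n (f n) ih).2
  exact ⟨f, fun n => (hg n (f n) (hf n)).1⟩

/-- Along any infinite path, the sets of states reachable from its vertices eventually all
merge. -/
lemma exists_merging [Finite Q] (E : ℕ → Q → Q → Prop) (r : ℕ → Q) (n₀ : ℕ)
    (hr : ∀ n, n₀ ≤ n → E n (r n) (r (n + 1))) :
    ∃ m, n₀ ≤ m ∧ ∀ l, m ≤ l → ∃ n, l ≤ n ∧ ∀ q, Reach E m (r m) n q → Reach E l (r l) n q := by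
  by_contra! h
  have key : ∀ j m, n₀ ≤ m → ∃ n₁, ∀ n, n₁ ≤ n → j ≤ {q | Reach E m (r m) n q}.ncard := by
    intro j
    induction j with
    | zero => exact fun m _ => ⟨0, fun _ _ => Nat.zero_le _⟩
    | succ j ih =>
      intro m hm
      obtain ⟨l, hml, hl⟩ := h m hm
      obtain ⟨n₁, hn₁⟩ := ih l (hm.trans hml)
      refine ⟨max n₁ l, fun n hn => ?_⟩
      obtain ⟨q, hq, hq'⟩ := hl n ((le_max_right _ _).trans hn)
      refine (hn₁ n ((le_max_left _ _).trans hn)).trans_lt (Set.ncard_lt_ncard ?_)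
      refine ⟨fun p hp => ?_, fun hsub => hq' (hsub hq)⟩
      exact (Reach.of_seq (fun k hk => hr k (hm.trans hk)) hml).trans hp
  obtain ⟨n, hn⟩ := key (Nat.card Q + 1) n₀ le_rfl
  have h1 := hn n le_rfl
  have h2 := Set.ncard_le_card {q | Reach E n₀ (r n₀) n q}
  omega

/-- The successors of `R` under the letter `a` via transitions in `X`. -/
def post (X : Set (Q × A × Q)) (R : Set Q) (a : A) : Set Q :=
  {q' | ∃ q ∈ R, (q, a, q') ∈ X}

/-- States of the breakpoint construction: the chosen disjunct, the set of reachable states, the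
set of those that have seen the current `Inf` set, and the index of the current `Inf` set. -/
abbrev DetState (Q D : Type) (k : ℕ) : Type := D × Set Q × Set Q × Fin (k + 1)

section Breakpoint

variable {D : Type} {k : ℕ} (δ : Set (Q × A × Q)) (F : D → Set (Q × A × Q))
  (T : D → Fin (k + 1) → Set (Q × A × Q))

/-- The reachable states after reading a letter. -/
def reachNext (x : DetState Q D k) (a : A) : Set Q :=
  post (δ \ F x.1) x.2.1 a

/-- The reachable states, after reading a letter, that have seen the current `Inf` set. -/
def markNext (x : DetState Q D k) (a : A) : Set Q :=
  post (δ \ F x.1) (x.2.2.1 ∩ x.2.1) a ∪ post ((δ \ F x.1) ∩ T x.1 x.2.2.2) x.2.1 a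

/-- All reachable states have seen the current `Inf` set. -/
def Break (x : DetState Q D k) (a : A) : Prop :=
  reachNext δ F x a ⊆ markNext δ F T x a

open Classical in
/-- The successor in the breakpoint construction. -/
noncomputable def detNext (x : DetState Q D k) (a : A) : DetState Q D k :=
  if Break δ F T x a then (x.1, reachNext δ F x a, ∅, x.2.2.2 + 1)
  else (x.1, reachNext δ F x a, markNext δ F T x a, x.2.2.2)

lemma detNext_fst (x : DetState Q D k) (a : A) : (detNext δ F T x a).1 = x.1 := by
  unfold detNext; split_ifs <;> rfl

lemma detNext_reach (x : DetState Q D k) (a : A) :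
    (detNext δ F T x a).2.1 = reachNext δ F x a := by
  unfold detNext; split_ifs <;> rfl

variable {δ F T}

lemma exists_first_break {x : ℕ → DetState Q D k} {u : ℕ → A} {m : ℕ}
    (hx : ∀ n, m ≤ n → x (n + 1) = detNext δ F T (x n) (u n))
    (hb : ∀ N, ∃ n, N ≤ n ∧ Break δ F T (x n) (u n)) {N : ℕ} (hN : m ≤ N) :
    ∃ n, N ≤ n ∧ Break δ F T (x n) (u n) ∧ (∀ l, N ≤ l → l < n → ¬ Break δ F T (x l) (u l)) ∧
      ∀ l, N ≤ l → l ≤ n → (x l).2.2.2 = (x N).2.2.2 := by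
  classical
  have h := hb N
  have hmin : ∀ l, N ≤ l → l < Nat.find h → ¬ Break δ F T (x l) (u l) :=
    fun l hl hlt hbr => Nat.find_min h hlt ⟨hl, hbr⟩
  refine ⟨Nat.find h, (Nat.find_spec h).1, (Nat.find_spec h).2, hmin, fun l hl => ?_⟩
  induction l, hl using Nat.le_induction with
  | base => exact fun _ => rfl
  | succ l hl ih =>
    intro hle
    rw [hx l (hN.trans hl), detNext, if_neg (hmin l hl (by omega))]
    exact ih (by omega)

lemma exists_index_eq {x : ℕ → DetState Q D k} {u : ℕ → A} {m : ℕ}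
    (hx : ∀ n, m ≤ n → x (n + 1) = detNext δ F T (x n) (u n))
    (hb : ∀ N, ∃ n, N ≤ n ∧ Break δ F T (x n) (u n)) {N : ℕ} (hN : m ≤ N) (j : Fin (k + 1)) :
    ∃ n, N ≤ n ∧ (x n).2.2.1 = ∅ ∧ (x n).2.2.2 = j := by
  have adv : ∀ N, m ≤ N →
      ∃ n, N ≤ n ∧ (x n).2.2.1 = ∅ ∧ (x n).2.2.2 = (x N).2.2.2 + 1 := by
    intro N hN
    obtain ⟨n, hn, hbr, -, hi⟩ := exists_first_break hx hb hN
    refine ⟨n + 1, by omega, ?_⟩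
    rw [hx n (hN.trans hn), detNext, if_pos hbr]
    exact ⟨rfl, by rw [hi n hn le_rfl]⟩
  have key : ∀ t, ∃ n, N ≤ n ∧ (x n).2.2.1 = ∅ ∧ (x n).2.2.2 = (x N).2.2.2 + 1 + t := by
    intro t
    induction t using Fin.induction with
    | zero => simpa using adv N hN
    | succ t ih =>
      obtain ⟨n, hn, -, hi⟩ := ih
      obtain ⟨n', hn', he, hi'⟩ := adv n (hN.trans hn)
      refine ⟨n', hn.trans hn', he, ?_⟩
      rw [hi', hi, ← Fin.coeSucc_eq_succ, add_assoc _ t.castSucc]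
  simpa using key (j - ((x N).2.2.2 + 1))

/-- A branch through the reachable states whose marks are always justified visits every `Inf` set
infinitely often, provided there are infinitely many breakpoints. -/
lemma exists_visit {x : ℕ → DetState Q D k} {u : ℕ → A} {m : ℕ}
    (hx : ∀ n, m ≤ n → x (n + 1) = detNext δ F T (x n) (u n))
    (hb : ∀ N, ∃ n, N ≤ n ∧ Break δ F T (x n) (u n)) {f : ℕ → Q}
    (hf : ∀ n, m ≤ n → f n ∈ (x n).2.1)
    (hmark : ∀ n, m ≤ n → f (n + 1) ∈ markNext δ F T (x n) (u n) →
      f n ∈ (x n).2.2.1 ∨ (f n, u n, f (n + 1)) ∈ T (x n).1 (x n).2.2.2)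
    (j : Fin (k + 1)) (N : ℕ) :
    ∃ n, N ≤ n ∧ m ≤ n ∧ (f n, u n, f (n + 1)) ∈ T (x n).1 j := by
  obtain ⟨n, hn, he, hj⟩ := exists_index_eq hx hb (le_max_right N m) j
  have hmn : m ≤ n := (le_max_right N m).trans hn
  obtain ⟨b, hnb, hbr, hno, hi⟩ := exists_first_break hx hb hmn
  by_contra! hcon
  have hT : ∀ l, n ≤ l → l ≤ b → (f l, u l, f (l + 1)) ∉ T (x l).1 (x l).2.2.2 := by
    intro l hl hlb
    rw [hi l hl hlb, hj]
    exact hcon l (((le_max_left N m).trans hn).trans hl) (hmn.trans hl)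
  have hB : ∀ l, n ≤ l → l ≤ b → f l ∉ (x l).2.2.1 := by
    intro l hl
    induction l, hl using Nat.le_induction with
    | base => simp [he]
    | succ l hl ih =>
      intro hlb
      rw [hx l (hmn.trans hl), detNext, if_neg (hno l hl (by omega))]
      intro hmem
      rcases hmark l (hmn.trans hl) hmem with h | h
      · exact ih (by omega) h
      · exact hT l hl (by omega) h
  have hfb := hf (b + 1) (by omega)
  rw [hx b (hmn.trans hnb), detNext_reach] at hfb
  rcases hmark b (hmn.trans hnb) (hbr hfb) with h | h
  · exact hB b hnb le_rfl h
  · exact hT b hnb le_rfl h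

/-- If the reachable sets along an infinitely often `Inf`-visiting path all merge, then there are
infinitely many breakpoints. -/
lemma exists_break {x : ℕ → DetState Q D k} {u : ℕ → A} {m : ℕ} {d : D} {r : ℕ → Q}
    (hx : ∀ n, m ≤ n → x (n + 1) = detNext δ F T (x n) (u n))
    (hd : ∀ n, m ≤ n → (x n).1 = d)
    (hR : ∀ n, m ≤ n →
      (x n).2.1 = {q | Reach (fun n p q => (p, u n, q) ∈ δ \ F d) m (r m) n q})
    (hr : ∀ n, m ≤ n → (r n, u n, r (n + 1)) ∈ δ \ F d)
    (hT : ∀ j N, ∃ n, N ≤ n ∧ (r n, u n, r (n + 1)) ∈ T d j)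
    (hmerge : ∀ l, m ≤ l → ∃ n, l ≤ n ∧
      ∀ q, Reach (fun n p q => (p, u n, q) ∈ δ \ F d) m (r m) n q →
        Reach (fun n p q => (p, u n, q) ∈ δ \ F d) l (r l) n q)
    (N : ℕ) : ∃ n, N ≤ n ∧ m ≤ n ∧ Break δ F T (x n) (u n) := by
  by_contra! hno
  let M := max N m
  have hmM : m ≤ M := le_max_right _ _
  have hno' : ∀ n, M ≤ n → ¬ Break δ F T (x n) (u n) :=
    fun n hn => hno n ((le_max_left _ _).trans hn) (hmM.trans hn)
  have hnext : ∀ n, M ≤ n → x (n + 1) =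
      (d, reachNext δ F (x n) (u n), markNext δ F T (x n) (u n), (x n).2.2.2) := by
    intro n hn
    rw [hx n (hmM.trans hn), detNext, if_neg (hno' n hn), hd n (hmM.trans hn)]
  have hidx : ∀ n, M ≤ n → (x n).2.2.2 = (x M).2.2.2 := by
    intro n hn
    induction n, hn using Nat.le_induction with
    | base => rfl
    | succ n hn ih => rw [hnext n hn]; exact ih
  obtain ⟨l, hl, hlT⟩ := hT (x M).2.2.2 M
  have hml : m ≤ l := hmM.trans hl
  have hmarked : ∀ n q, Reach (fun n p q => (p, u n, q) ∈ δ \ F d) (l + 1) (r (l + 1)) n q →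
      q ∈ (x n).2.2.1 := by
    intro n q h
    induction h with
    | base =>
      rw [hnext l hl]
      refine Or.inr ⟨r l, ?_, ?_⟩
      · rw [hR l hml]
        exact Reach.of_seq (E := fun n p q => (p, u n, q) ∈ δ \ F d) hr hml
      · rw [hidx l hl, hd l hml]
        exact ⟨hr l hml, hlT⟩
    | @step n p q h he ih =>
      have hle := h.le
      rw [hnext n (by omega)]
      refine Or.inl ⟨p, ⟨ih, ?_⟩, ?_⟩
      · rw [hR n (by omega)]
        exact (Reach.of_seq (E := fun n p q => (p, u n, q) ∈ δ \ F d) hr (by omega)).trans h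
      · rw [hd n (by omega)]
        exact he
  obtain ⟨n, hn, hsub⟩ := hmerge (l + 1) (by omega)
  obtain ⟨n, rfl⟩ : ∃ n', n = n' + 1 := ⟨n - 1, by omega⟩
  refine hno' n (by omega) fun q hq => ?_
  have hRn := hR (n + 1) (by omega)
  have hq' : q ∈ (x (n + 1)).2.1 := by rw [hnext n (by omega)]; exact hq
  rw [hRn] at hq'
  have := hmarked _ q (hsub q hq')
  rwa [hnext n (by omega)] at this

variable (δ F T)

/-- Transitions of the limit-deterministic automaton: simulate the original automaton, then jump
into the breakpoint construction for some disjunct. -/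
def ldStep : Q ⊕ DetState Q D k → A → Q ⊕ DetState Q D k → Prop
  | .inl q, a, .inl q' => (q, a, q') ∈ δ
  | .inl q, a, .inr x => ∃ d q', (q, a, q') ∈ δ ∧ x = (d, {q'}, ∅, 0)
  | .inr _, _, .inl _ => False
  | .inr x, a, .inr y => (reachNext δ F x a).Nonempty ∧ y = detNext δ F T x a

/-- The accepting transitions of the limit-deterministic automaton. -/
def ldAcc : Set ((Q ⊕ DetState Q D k) × A × (Q ⊕ DetState Q D k)) :=
  {t | ldStep δ F T t.1 t.2.1 t.2.2 ∧ ∃ x, t.1 = .inr x ∧ Break δ F T x t.2.1}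

/-- The limit-deterministic Büchi automaton for a disjunction of generalized Rabin pairs. -/
def ldAut (I : Set Q) : TELA (Q ⊕ DetState Q D k) A where
  delta := {t | ldStep δ F T t.1 t.2.1 t.2.2}
  init := Sum.inl '' I
  acc := .inf (ldAcc δ F T)

/-- The set of original states tracked by a state of the limit-deterministic automaton. -/
def support : Q ⊕ DetState Q D k → Set Q
  | .inl q => {q}
  | .inr x => x.2.1

variable {δ F T}

lemma exists_inr_of_ldStep {x : DetState Q D k} {a : A} {s : Q ⊕ DetState Q D k}
    (h : ldStep δ F T (.inr x) a s) : ∃ y, s = .inr y := by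
  cases s with
  | inl q => exact h.elim
  | inr y => exact ⟨y, rfl⟩

lemma inr_of_le {s : ℕ → Q ⊕ DetState Q D k} {u : ℕ → A}
    (hs : ∀ n, ldStep δ F T (s n) (u n) (s (n + 1))) {m : ℕ} {x : DetState Q D k}
    (hm : s m = .inr x) {n : ℕ} (hn : m ≤ n) : ∃ y, s n = .inr y := by
  induction n, hn using Nat.le_induction with
  | base => exact ⟨x, hm⟩
  | succ n hn ih =>
    obtain ⟨y, hy⟩ := ih
    have := hs n
    rw [hy] at this
    exact exists_inr_of_ldStep this

lemma support_nonempty_of_ldStep {s s' : Q ⊕ DetState Q D k} {a : A}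
    (h : ldStep δ F T s a s') : (support s').Nonempty := by
  match s, s', h with
  | .inl _, .inl _, _ => exact Set.singleton_nonempty _
  | .inl _, .inr _, ⟨_, q', _, hx⟩ => subst hx; exact Set.singleton_nonempty q'
  | .inr x, .inr _, ⟨hne, hy⟩ => subst hy; simpa [support, detNext_reach] using hne

lemma exists_pred_of_ldStep {s s' : Q ⊕ DetState Q D k} {a : A}
    (h : ldStep δ F T s a s') {q : Q} (hq : q ∈ support s') :
    ∃ p ∈ support s, (p, a, q) ∈ δ ∧ ∀ x, s = .inr x → (p, a, q) ∉ F x.1 ∧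
      (q ∈ markNext δ F T x a → p ∈ x.2.2.1 ∨ (p, a, q) ∈ T x.1 x.2.2.2) := by
  match s, s', h with
  | .inl p, .inl q', h =>
    obtain rfl : q = q' := hq
    exact ⟨p, rfl, h, fun x hx => by simp at hx⟩
  | .inl p, .inr _, ⟨_, q', h, hx⟩ =>
    subst hx
    obtain rfl : q = q' := hq
    exact ⟨p, rfl, h, fun x hx => by simp at hx⟩
  | .inr x, .inr _, ⟨_, hy⟩ =>
    subst hy
    simp only [support, detNext_reach] at hq
    by_cases hm : q ∈ markNext δ F T x a
    · rcases hm with ⟨p, hp, hpq⟩ | ⟨p, hp, hpq⟩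
      · refine ⟨p, hp.2, hpq.1, ?_⟩
        rintro _ ⟨⟩
        exact ⟨hpq.2, fun _ => Or.inl hp.1⟩
      · refine ⟨p, hp, hpq.1.1, ?_⟩
        rintro _ ⟨⟩
        exact ⟨hpq.1.2, fun _ => Or.inr hpq.2⟩
    · obtain ⟨p, hp, hpq⟩ := hq
      refine ⟨p, hp, hpq.1, ?_⟩
      rintro _ ⟨⟩
      exact ⟨hpq.2, fun h => absurd h hm⟩

lemma ldStep_of_isRun {I : Set Q} {u : ℕ → A}
    {σ : ℕ → (Q ⊕ DetState Q D k) × A × (Q ⊕ DetState Q D k)}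
    (hσ : (ldAut δ F T I).IsRun u σ) (n : ℕ) :
    ldStep δ F T (σ n).1 (u n) (σ (n + 1)).1 := by
  obtain ⟨h1, h2, h3⟩ := hσ.2 n
  rw [← h2, ← h3]
  exact h1

lemma ldAut_limitDet (I : Set Q) : (ldAut δ F T I).LimitDet := by
  refine ⟨Set.range Sum.inr, ?_, ?_, ?_⟩
  · rintro ⟨s, a, s'⟩ h ⟨x, hx⟩
    obtain rfl : Sum.inr x = s := hx
    obtain ⟨y, rfl⟩ := exists_inr_of_ldStep h
    exact ⟨y, rfl⟩
  · rintro _ ⟨x, rfl⟩ a s₁ s₂ h₁ h₂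
    obtain ⟨y₁, rfl⟩ := exists_inr_of_ldStep h₁
    obtain ⟨y₂, rfl⟩ := exists_inr_of_ldStep h₂
    rw [h₁.2, h₂.2]
  · rintro u ρ hρ ⟨t, ht, -, x, hx, -⟩
    obtain ⟨m, -, hm⟩ := ht 0
    rw [Set.eq_empty_iff_forall_notMem]
    rintro t' ⟨ht', hN, -⟩
    obtain ⟨n, hn, rfl⟩ := ht' m
    obtain ⟨y, hy⟩ := inr_of_le (s := fun n => (ρ n).1) (ldStep_of_isRun hρ) (hm ▸ hx) hn
    exact hN ⟨y, hy.symm⟩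

lemma ldAut_lang_subset [Finite Q] [Finite A] [Finite D] (M : TELA Q A)
    (hacc : ∀ X : Set (Q × A × Q), X.Nonempty →
      (∃ d, X ∩ F d = ∅ ∧ ∀ j, (X ∩ T d j).Nonempty) → M.acc.sat X) :
    (ldAut M.delta F T M.init).Lang ⊆ M.Lang := by
  rintro u ⟨σ, hσ, hsat⟩
  have hs := ldStep_of_isRun hσ
  have hbr := (infOcc_inter_nonempty _ _).1 hsat
  obtain ⟨q₀, hq₀, hσ₀⟩ := hσ.1
  have hV : ∀ n, (support (σ n).1).Nonempty := by
    rintro (_ | n)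
    · rw [← hσ₀]
      exact Set.singleton_nonempty q₀
    · exact support_nonempty_of_ldStep (hs n)
  obtain ⟨f, hf⟩ := exists_seq_of_layers _ _ hV fun n q hq => exists_pred_of_ldStep (hs n) hq
  obtain ⟨m, -, -, x₀, hm, -⟩ := hbr 0
  have hex : ∀ n, ∃ y, m ≤ n → (σ n).1 = .inr y := by
    intro n
    by_cases hn : m ≤ n
    · obtain ⟨y, hy⟩ := inr_of_le (s := fun n => (σ n).1) hs hm hn
      exact ⟨y, fun _ => hy⟩
    · exact ⟨x₀, fun h => absurd h hn⟩
  choose x hsx using hex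
  have hx : ∀ n, m ≤ n → x (n + 1) = detNext M.delta F T (x n) (u n) := by
    intro n hn
    have := hs n
    rw [hsx n hn, hsx (n + 1) (by omega)] at this
    exact this.2
  have hd : ∀ n, m ≤ n → (x n).1 = (x m).1 := by
    intro n hn
    induction n, hn using Nat.le_induction with
    | base => rfl
    | succ n hn ih => rw [hx n hn, detNext_fst, ih]
  have hb : ∀ N, ∃ n, N ≤ n ∧ Break M.delta F T (x n) (u n) := by
    intro N
    obtain ⟨n, hn, -, y, hy, hbrk⟩ := hbr (max N m)
    rw [hsx n ((le_max_right _ _).trans hn)] at hy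
    rw [(hσ.2 n).2.1] at hbrk
    exact ⟨n, (le_max_left _ _).trans hn, Sum.inr.inj hy ▸ hbrk⟩
  refine ⟨fun n => (f n, u n, f (n + 1)), ⟨?_, fun n => ⟨(hf n).2.1, rfl, rfl⟩⟩, ?_⟩
  · have h0 := (hf 0).1
    rw [← hσ₀] at h0
    obtain rfl : f 0 = q₀ := h0
    exact hq₀
  · refine hacc _ ?_ ⟨(x m).1, ?_, fun j => ?_⟩
    · rw [← Set.inter_univ (infOcc _), infOcc_inter_nonempty]
      exact fun N => ⟨N, le_rfl, trivial⟩
    · rw [infOcc_inter_eq_empty]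
      exact ⟨m, fun n hn => hd n hn ▸ ((hf n).2.2 _ (hsx n hn)).1⟩
    · rw [infOcc_inter_nonempty]
      intro N
      obtain ⟨n, hn, hmn, h⟩ := exists_visit hx hb (f := f)
        (fun n hn => by simpa [support, hsx n hn] using (hf n).1)
        (fun n hn => ((hf n).2.2 _ (hsx n hn)).2) j N
      exact ⟨n, hn, hd n hmn ▸ h⟩

lemma subset_ldAut_lang [Finite Q] [Finite A] [Finite D] (M : TELA Q A)
    (hacc : ∀ X : Set (Q × A × Q), X.Nonempty → M.acc.sat X →
      ∃ d, X ∩ F d = ∅ ∧ ∀ j, (X ∩ T d j).Nonempty) :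
    M.Lang ⊆ (ldAut M.delta F T M.init).Lang := by
  rintro u ⟨ρ, hρ, hsat⟩
  let r : ℕ → Q := fun n => (ρ n).1
  have hρr : ∀ n, ρ n = (r n, u n, r (n + 1)) := by
    intro n
    obtain ⟨-, h2, h3⟩ := hρ.2 n
    simp only [r, ← h2, ← h3]
  have hδ : ∀ n, (r n, u n, r (n + 1)) ∈ M.delta := fun n => hρr n ▸ (hρ.2 n).1
  obtain ⟨d, hF, hT⟩ := hacc (infOcc ρ) (by
    rw [← Set.inter_univ (infOcc _), infOcc_inter_nonempty]
    exact fun N => ⟨N, le_rfl, trivial⟩) hsat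
  obtain ⟨n₀, hn₀⟩ := (infOcc_inter_eq_empty _ _).1 hF
  let E : ℕ → Q → Q → Prop := fun n p q => (p, u n, q) ∈ M.delta \ F d
  have hr : ∀ n, n₀ ≤ n → E n (r n) (r (n + 1)) := fun n hn => ⟨hδ n, hρr n ▸ hn₀ n hn⟩
  obtain ⟨m, hm, hmerge⟩ := exists_merging E r (n₀ + 1) fun n hn => hr n (by omega)
  obtain ⟨m, rfl⟩ : ∃ m', m = m' + 1 := ⟨m - 1, by omega⟩
  let x₀ : DetState Q D k := (d, {r (m + 1)}, ∅, 0)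
  let x : ℕ → DetState Q D k :=
    fun n => Nat.rec x₀ (fun n y => if n = m then x₀ else detNext M.delta F T y (u n)) n
  have hxm : x (m + 1) = x₀ := if_pos rfl
  have hx : ∀ n, m + 1 ≤ n → x (n + 1) = detNext M.delta F T (x n) (u n) :=
    fun n hn => if_neg (by omega)
  have hd : ∀ n, m + 1 ≤ n → (x n).1 = d := by
    intro n hn
    induction n, hn using Nat.le_induction with
    | base => rw [hxm]
    | succ n hn ih => rw [hx n hn, detNext_fst, ih]
  have hR : ∀ n, m + 1 ≤ n → (x n).2.1 = {q | Reach E (m + 1) (r (m + 1)) n q} := by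
    intro n hn
    induction n, hn using Nat.le_induction with
    | base =>
      rw [hxm]
      ext q
      constructor
      · intro h
        obtain rfl : q = r (m + 1) := h
        exact .base
      · exact fun h => h.eq_of_self
    | succ n hn ih =>
      rw [hx n hn, detNext_reach, reachNext, ih, hd n hn]
      ext q
      exact ⟨fun ⟨p, hp, he⟩ => Reach.step hp he, fun h => h.last hn⟩
  have hrm : ∀ n, m + 1 ≤ n → E n (r n) (r (n + 1)) := fun n hn => hr n (by omega)
  have hmem : ∀ n, m + 1 ≤ n → r n ∈ (x n).2.1 := by
    intro n hn
    rw [hR n hn]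
    exact Reach.of_seq hrm hn
  have hbreak := exists_break hx hd hR hrm
    (fun j N => by
      obtain ⟨n, hn, h⟩ := (infOcc_inter_nonempty _ _).1 (hT j) N
      exact ⟨n, hn, hρr n ▸ h⟩) hmerge
  let s : ℕ → Q ⊕ DetState Q D k := fun n => if n ≤ m then .inl (r n) else .inr (x n)
  have hs_inl : ∀ n, n ≤ m → s n = .inl (r n) := fun n hn => if_pos hn
  have hs_inr : ∀ n, m + 1 ≤ n → s n = .inr (x n) := fun n hn => if_neg (by omega)
  have hs : ∀ n, ldStep M.delta F T (s n) (u n) (s (n + 1)) := by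
    intro n
    rcases lt_trichotomy n m with hn | rfl | hn
    · rw [hs_inl n hn.le, hs_inl (n + 1) hn]
      exact hδ n
    · rw [hs_inl n le_rfl, hs_inr (n + 1) le_rfl, hxm]
      exact ⟨d, r (n + 1), hδ n, rfl⟩
    · rw [hs_inr n hn, hs_inr (n + 1) (by omega)]
      refine ⟨⟨r (n + 1), ?_⟩, hx n hn⟩
      rw [← detNext_reach M.delta F T, ← hx n hn]
      exact hmem (n + 1) (by omega)
  refine ⟨fun n => (s n, u n, s (n + 1)), ⟨?_, fun n => ⟨hs n, rfl, rfl⟩⟩, ?_⟩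
  · exact ⟨r 0, hρ.1, (hs_inl 0 (Nat.zero_le m)).symm⟩
  · refine (infOcc_inter_nonempty _ _).2 fun N => ?_
    obtain ⟨n, hn, hmn, hbr⟩ := hbreak N
    exact ⟨n, hn, hs n, x n, hs_inr n hmn, hbr⟩

end Breakpoint

lemma card_ld_le [Finite Q] {D : Type} [Finite D] {k : ℕ} (hD : Nat.card D ≤ 2 ^ (k + 1)) :
    Nat.card (Q ⊕ DetState Q D k) ≤ 2 ^ (2 * (k + 1 + Nat.card Q) + 2) := by
  have hset : Nat.card (Set Q) = 2 ^ Nat.card Q := by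
    have := Fintype.ofFinite Q
    simp [Nat.card_eq_fintype_card]
  rw [Nat.card_sum, Nat.card_prod, Nat.card_prod, Nat.card_prod, hset, Nat.card_fin]
  generalize Nat.card Q = N
  have h1 : N ≤ 2 ^ N := Nat.lt_two_pow_self.le
  have h2 : k + 1 ≤ 2 ^ (k + 1) := Nat.lt_two_pow_self.le
  have h3 : 1 ≤ 2 ^ N := Nat.one_le_two_pow
  have h4 : 1 ≤ 2 ^ (k + 1) := Nat.one_le_two_pow
  rw [show 2 ^ (2 * (k + 1 + N) + 2) =
    4 * ((2 ^ (k + 1) * 2 ^ (k + 1)) * (2 ^ N * 2 ^ N)) by ring]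
  generalize 2 ^ N = a at *
  generalize 2 ^ (k + 1) = b at *
  have h5 : N ≤ (b * b) * (a * a) := by
    calc N ≤ a := h1
      _ = (1 * 1) * (1 * a) := by ring
      _ ≤ (b * b) * (a * a) := by gcongr
  have h6 : Nat.card D * (a * (a * (k + 1))) ≤ b * (a * (a * b)) := by gcongr
  nlinarith

end Auxiliary

/-- For every TELA `B` with `N ≥ 1` states and acceptance
condition `β` (not necessarily in DNF) there exists an equivalent
limit-deterministic Büchi automaton `G` (acceptance of the form `Inf(T)`)
with at most `2^(2(|β|+N)+2)` states. -/
theorem limitDeterminization_singleExp {Q A : Type} [Finite Q] [Finite A]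
    (B : TELA Q A) (hwf : B.acc.wf B.delta) (hN : 1 ≤ Nat.card Q) :
    ∃ (S : Type) (_ : Finite S) (G : TELA S A) (Ts : Set (S × A × S)),
      Ts ⊆ G.delta ∧
      G.acc = AccCond.inf Ts ∧
      G.LimitDet ∧
      G.Lang = B.Lang ∧
      Nat.card S ≤ 2 ^ (2 * (B.acc.size + Nat.card Q) + 2) := by
  obtain ⟨D, _, F, T, hcard, hT, hdnf⟩ := B.acc.exists_dnf
  obtain ⟨k, hk⟩ : ∃ k, B.acc.size = k + 1 := ⟨B.acc.size - 1, by
    have := B.acc.one_le_size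
    omega⟩
  have hacc : ∀ X : Set (Q × A × Q), X.Nonempty → (B.acc.sat X ↔
      ∃ d, X ∩ F d = ∅ ∧ ∀ j : Fin (k + 1), (X ∩ T d j).Nonempty) := by
    intro X hX
    rw [hdnf X hX]
    refine exists_congr fun d => and_congr_right fun _ => ⟨fun h j => h j, fun h i => ?_⟩
    by_cases hi : i < k + 1
    · exact h ⟨i, hi⟩
    · rw [hT d i (by omega)]
      simpa using hX
  let T' : D → Fin (k + 1) → Set (Q × A × Q) := fun d j => T d j
  rw [hk] at hcard ⊢
  exact ⟨Q ⊕ DetState Q D k, inferInstance, ldAut B.delta F T' B.init, ldAcc B.delta F T',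
    fun _ h => h.1, rfl, ldAut_limitDet B.init,
    (ldAut_lang_subset B fun X hX => (hacc X hX).2).antisymm
      (subset_ldAut_lang B fun X hX => (hacc X hX).1),
    card_ld_le hcard⟩

end TELAFormal
end
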